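/- Strict progress of DMIS phases: if the undecided set U_k after k phases is nonempty, then U_{k+1} is a strict subset of U_k. -/

import Mathlib

/-- Set of priority-local maxima of `U` in graph `G`. -/
def locMax {V : Type*} (G : SimpleGraph V) (p : V → ℕ) (U : Set V) : Set V :=
  {v | v ∈ U ∧ ∀ u ∈ U, G.Adj v u → p u < p v}

/-- DMIS phase iteration: undecided vertices after `k` phases. -/
def undecided {V : Type*} (G : SimpleGraph V) (p : V → ℕ) : ℕ → Set V
  | 0 => Set.univ
  | k + 1 =>
      undecided G p k \
        (locMax G p (undecided G p k) ∪
          {w | ∃ v ∈ locMax G p (undecided G p k), G.Adj v w})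

theorem locMax_subset {V : Type*} (G : SimpleGraph V) (p : V → ℕ) (U : Set V) :
    locMax G p U ⊆ U :=
  fun _ hv => hv.1

/-- A nonempty finite set has a local maximum for any injective priority. -/
theorem locMax_nonempty {V : Type*} (G : SimpleGraph V) {p : V → ℕ}
    (hp : Function.Injective p) {U : Set V} (hfin : U.Finite) (hU : U.Nonempty) :
    (locMax G p U).Nonempty := by
  obtain ⟨v, hv, hmax⟩ := Set.exists_max_image U p hfin hU
  exact ⟨v, hv, fun u hu hadj => (hmax u hu).lt_of_ne (hp.ne hadj.ne')⟩

theorem dmis_strict_progress {V : Type*} [Fintype V] (G : SimpleGraph V) (p : V → ℕ)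
    (hp : Function.Injective p) (k : ℕ) (h : (undecided G p k).Nonempty) :
    undecided G p (k + 1) ⊂ undecided G p k := by
  obtain ⟨v, hv⟩ := locMax_nonempty G hp (Set.toFinite _) h
  exact (Set.ssubset_iff_of_subset Set.sdiff_subset).2
    ⟨v, locMax_subset G p _ hv, fun hmem => hmem.2 (Or.inl hv)⟩
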